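/- Fix n ≥ 2, v ∈ S_n, and k ∈ {1,…,n−1}. If σ_k ∈ supp(v) and ℓ(vσ_k) = ℓ(v) + 1, then the permutation v' := vσ_k has a 321-pattern or a 3412-pattern that straddles k in both position and value. -/

import Mathlib

/-- The simple reflection `σ_i = (i, i+1)`, acting on `ℕ` (1-indexed positions/values). -/
def simpleRefl (i : ℕ) : Equiv.Perm ℕ := Equiv.swap i (i + 1)

/-- `w` is a permutation of `{1, …, n}`: it fixes every point outside `[1, n]`. -/
def IsPermOf (n : ℕ) (w : Equiv.Perm ℕ) : Prop :=
  ∀ x : ℕ, x ∉ Finset.Icc 1 n → w x = x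

/-- The Coxeter length of `w`: its number of inversions on `{1, …, n}`. -/
def len (n : ℕ) (w : Equiv.Perm ℕ) : ℕ :=
  ((Finset.Icc 1 n ×ˢ Finset.Icc 1 n).filter fun p => p.1 < p.2 ∧ w p.2 < w p.1).card

/-- `L` is a word for `w`: a list of indices in `[1, n-1]` whose associated product of
simple reflections (read left to right) is `w`. -/
def IsWord (n : ℕ) (w : Equiv.Perm ℕ) (L : List ℕ) : Prop :=
  (∀ i ∈ L, 1 ≤ i ∧ i ≤ n - 1) ∧ (L.map simpleRefl).prod = w

/-- `L` is a reduced decomposition of `w`. -/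
def IsReducedWord (n : ℕ) (w : Equiv.Perm ℕ) (L : List ℕ) : Prop :=
  IsWord n w L ∧ L.length = len n w

/-- `min_k(w)`: the minimum number of occurrences of `σ_k` in a reduced decomposition of `w`. -/
noncomputable def minOcc (n k : ℕ) (w : Equiv.Perm ℕ) : ℕ :=
  sInf {m | ∃ L : List ℕ, IsReducedWord n w L ∧ L.count k = m}

/-- `max_k(w)`: the maximum number of occurrences of `σ_k` in a reduced decomposition of `w`. -/
noncomputable def maxOcc (n k : ℕ) (w : Equiv.Perm ℕ) : ℕ :=
  sSup {m | ∃ L : List ℕ, IsReducedWord n w L ∧ L.count k = m}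

/-- `expat_k(w) = |{w(1),…,w(k)} ∩ {k+1,…,n}|`. -/
def expat (n k : ℕ) (w : Equiv.Perm ℕ) : ℕ :=
  (((Finset.Icc 1 k).image fun i => w i) ∩ Finset.Icc (k + 1) n).card

/-- A `321`-pattern of `w` in positions `i1 < i2 < i3` (within `[1, n]`). -/
def Is321At (n : ℕ) (w : Equiv.Perm ℕ) (i1 i2 i3 : ℕ) : Prop :=
  1 ≤ i1 ∧ i1 < i2 ∧ i2 < i3 ∧ i3 ≤ n ∧ w i3 < w i2 ∧ w i2 < w i1

/-- A `3412`-pattern of `w` in positions `i1 < i2 < i3 < i4` (within `[1, n]`). -/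
def Is3412At (n : ℕ) (w : Equiv.Perm ℕ) (i1 i2 i3 i4 : ℕ) : Prop :=
  1 ≤ i1 ∧ i1 < i2 ∧ i2 < i3 ∧ i3 < i4 ∧ i4 ≤ n ∧
    w i3 < w i4 ∧ w i4 < w i1 ∧ w i1 < w i2

/-- `p` is a position pair at `k`: `p = (i1, i3)` for a `321`-pattern with `i1 ≤ k < i3`,
or `p = (i2, i3)` for a `3412`-pattern with `i2 ≤ k < i3`. -/
def IsPosPair (n k : ℕ) (w : Equiv.Perm ℕ) (p : ℕ × ℕ) : Prop :=
  (∃ i2, Is321At n w p.1 i2 p.2 ∧ p.1 ≤ k ∧ k < p.2) ∨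
  (∃ i1 i4, Is3412At n w i1 p.1 p.2 i4 ∧ p.1 ≤ k ∧ k < p.2)

/-- `p` is a value pair at `k`: `p = (j3, j1)` for a `321`-pattern with values
`j1 < j2 < j3` and `j1 ≤ k < j3`, or `p = (j4, j1)` for a `3412`-pattern with values
`j1 < j2 < j3 < j4` and `j2 ≤ k < j3`. -/
def IsValPair (n k : ℕ) (w : Equiv.Perm ℕ) (p : ℕ × ℕ) : Prop :=
  (∃ i1 i2 i3, Is321At n w i1 i2 i3 ∧ w i3 ≤ k ∧ k < w i1 ∧ p = (w i1, w i3)) ∨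
  (∃ i1 i2 i3 i4, Is3412At n w i1 i2 i3 i4 ∧ w i4 ≤ k ∧ k < w i1 ∧ p = (w i2, w i3))

/-- `PosPair_k(w)`: the number of distinct position pairs at `k` in `w`. -/
noncomputable def posPairCount (n k : ℕ) (w : Equiv.Perm ℕ) : ℕ :=
  Set.ncard {p : ℕ × ℕ | IsPosPair n k w p}

/-- `ValPair_k(w)`: the number of distinct value pairs at `k` in `w`. -/
noncomputable def valPairCount (n k : ℕ) (w : Equiv.Perm ℕ) : ℕ :=
  Set.ncard {p : ℕ × ℕ | IsValPair n k w p}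


theorem sr_apply (a x : ℕ) :
    simpleRefl a x = if x = a then a + 1 else if x = a + 1 then a else x := by
  simp only [simpleRefl, Equiv.swap_apply_def]

theorem sr_sr (a x : ℕ) : simpleRefl a (simpleRefl a x) = x := by
  simp only [simpleRefl, Equiv.swap_apply_self]

theorem len_up (n : ℕ) (w : Equiv.Perm ℕ) (a : ℕ) (h1 : 1 ≤ a) (h2 : a ≤ n - 1)
    (h : w a < w (a + 1)) : len n (w * simpleRefl a) = len n w + 1 := by
  unfold len
  have hinj : Function.Injective (fun p : ℕ × ℕ => (simpleRefl a p.1, simpleRefl a p.2)) := by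
    rintro ⟨x, y⟩ ⟨x', y'⟩ hxy
    simpa using hxy
  rw [← Finset.card_image_of_injective
    ((Finset.Icc 1 n ×ˢ Finset.Icc 1 n).filter fun p => p.1 < p.2 ∧ w p.2 < w p.1) hinj]
  rw [← Finset.card_insert_of_notMem (a := (a, a + 1))]
  · congr 1
    ext ⟨x, y⟩
    rw [Finset.mem_filter]
    simp only [Finset.mem_filter, Finset.mem_product, Finset.mem_Icc, Finset.mem_insert,
      Finset.mem_image, Prod.mk.injEq, Prod.exists, Equiv.Perm.mul_apply]
    constructor
    · rintro ⟨hb, hlt, hw⟩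
      by_cases hxy : x = a ∧ y = a + 1
      · exact Or.inl hxy
      · right
        refine ⟨simpleRefl a x, simpleRefl a y, ⟨?_, ?_, hw⟩, sr_sr _ _, sr_sr _ _⟩
        · rw [sr_apply, sr_apply]; split_ifs <;> omega
        · rw [sr_apply, sr_apply]; split_ifs <;> omega
    · rintro (⟨rfl, rfl⟩ | ⟨x', y', ⟨hb, hlt, hw⟩, rfl, rfl⟩)
      · refine ⟨by omega, by omega, ?_⟩
        simpa [simpleRefl] using h
      · have hne : ¬ (x' = a ∧ y' = a + 1) := by
          rintro ⟨rfl, rfl⟩; omega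
        refine ⟨?_, ?_, by simpa only [sr_sr] using hw⟩
        · rw [sr_apply, sr_apply]; split_ifs <;> omega
        · rw [sr_apply, sr_apply]; split_ifs <;> omega
  · simp only [Finset.mem_filter, Finset.mem_product, Finset.mem_Icc,
      Finset.mem_image, Prod.mk.injEq, Prod.exists, not_exists, not_and]
    rintro x y ⟨hb, hlt, hw⟩ hx hy
    rw [sr_apply] at hx hy
    split_ifs at hx hy <;> omega

theorem len_down (n : ℕ) (w : Equiv.Perm ℕ) (a : ℕ) (h1 : 1 ≤ a) (h2 : a ≤ n - 1)
    (h : w (a + 1) < w a) : len n w = len n (w * simpleRefl a) + 1 := by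
  have := len_up n (w * simpleRefl a) a h1 h2 (by simpa [simpleRefl] using h)
  rwa [mul_assoc, simpleRefl, Equiv.swap_mul_self, mul_one] at this

theorem len_cases (n : ℕ) (w : Equiv.Perm ℕ) (a : ℕ) (h1 : 1 ≤ a) (h2 : a ≤ n - 1) :
    (w a < w (a + 1) ∧ len n (w * simpleRefl a) = len n w + 1) ∨
    len n (w * simpleRefl a) + 1 = len n w := by
  rcases lt_trichotomy (w a) (w (a + 1)) with h | h | h
  · exact Or.inl ⟨h, len_up n w a h1 h2 h⟩
  · have := w.injective h; omega
  · exact Or.inr (len_down n w a h1 h2 h).symm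

theorem len_one (n : ℕ) : len n 1 = 0 := by
  unfold len
  rw [Finset.card_eq_zero, Finset.filter_eq_empty_iff]
  rintro ⟨x, y⟩ _ h
  simp at h
  omega

theorem len_word_le (n : ℕ) (L : List ℕ) (hL : ∀ i ∈ L, 1 ≤ i ∧ i ≤ n - 1) :
    len n (L.map simpleRefl).prod ≤ L.length := by
  induction L using List.reverseRecOn with
  | nil => simp [len_one]
  | append_singleton L a ih =>
    have ih := ih (fun i hi => hL i (by simp [hi]))
    have ha := hL a (by simp)
    have := len_cases n (L.map simpleRefl).prod a ha.1 ha.2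
    simp only [List.map_append, List.prod_append, List.map_cons, List.map_nil,
      List.prod_singleton, List.length_append, List.length_singleton]
    omega

theorem word_pres (k : ℕ) (L : List ℕ) (hk : k ∉ L) (x : ℕ) :
    (L.map simpleRefl).prod x ≤ k ↔ x ≤ k := by
  induction L with
  | nil => simp
  | cons a L ih =>
    simp only [List.mem_cons, not_or] at hk
    rw [List.map_cons, List.prod_cons, Equiv.Perm.mul_apply, ← ih hk.2, sr_apply]
    split_ifs <;> omega

theorem exists_inv (n k : ℕ) (L : List ℕ) (hL : ∀ i ∈ L, 1 ≤ i ∧ i ≤ n - 1)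
    (hr : L.length = len n (L.map simpleRefl).prod) (hk : k ∈ L) :
    ∃ i j, i < j ∧ (L.map simpleRefl).prod j ≤ k ∧ k < (L.map simpleRefl).prod i := by
  induction L using List.reverseRecOn with
  | nil => simp at hk
  | append_singleton L a ih =>
    have hL' : ∀ i ∈ L, 1 ≤ i ∧ i ≤ n - 1 := fun i hi => hL i (by simp [hi])
    have ha := hL a (by simp)
    have hle := len_word_le n L hL'
    have hc := len_cases n (L.map simpleRefl).prod a ha.1 ha.2
    have hp := word_pres k L
    simp only [List.map_append, List.prod_append, List.map_cons, List.map_nil,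
      List.prod_singleton, List.length_append, List.length_singleton] at hr ⊢
    have hlt : (L.map simpleRefl).prod a < (L.map simpleRefl).prod (a + 1) := by omega
    have ih := ih hL' (by omega)
    generalize (L.map simpleRefl).prod = w at *
    by_cases hkL : k ∈ L
    · obtain ⟨i, j, hij, hj, hi⟩ := ih hkL
      refine ⟨simpleRefl a i, simpleRefl a j, ?_, ?_, ?_⟩
      · have : ¬ (i = a ∧ j = a + 1) := by
          rintro ⟨rfl, rfl⟩; omega
        rw [sr_apply, sr_apply]; split_ifs <;> omega
      · rwa [Equiv.Perm.mul_apply, sr_sr]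
      · rwa [Equiv.Perm.mul_apply, sr_sr]
    · have hka : k = a := by simpa [hkL] using hk
      subst hka
      have e1 := hp hkL k
      have e2 := hp hkL (k + 1)
      refine ⟨k, k + 1, by omega, ?_, ?_⟩
      · simp [simpleRefl]; omega
      · simp [simpleRefl]; omega

theorem pres_compl (w : Equiv.Perm ℕ) (k : ℕ) (h : ∀ i ≤ k, w i ≤ k) (j : ℕ) (hj : w j ≤ k) :
    j ≤ k := by
  have hs : (Finset.Iic k).image w = Finset.Iic k := by
    apply Finset.eq_of_subset_of_card_le
    · intro x hx
      simp only [Finset.mem_image, Finset.mem_Iic] at hx ⊢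
      obtain ⟨y, hy, rfl⟩ := hx
      exact h y hy
    · rw [Finset.card_image_of_injective _ w.injective]
  have : w j ∈ (Finset.Iic k).image w := by rw [hs]; simpa using hj
  simpa using this

/-- If `σ_k ∈ supp(v)` and `ℓ(vσ_k) = ℓ(v) + 1`, then `v' = vσ_k`
has a `321`-pattern or a `3412`-pattern straddling `k` in both position and value. -/
theorem straddling_of_mul_simpleRefl (n : ℕ) (hn : 2 ≤ n) (v : Equiv.Perm ℕ)
    (hv : IsPermOf n v) (k : ℕ) (hk1 : 1 ≤ k) (hk2 : k ≤ n - 1)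
    (hsupp : ∃ L : List ℕ, IsReducedWord n v L ∧ k ∈ L)
    (hlen : len n (v * simpleRefl k) = len n v + 1) :
    (∃ i1 i2 i3, Is321At n (v * simpleRefl k) i1 i2 i3 ∧ i1 ≤ k ∧ k < i3 ∧
        (v * simpleRefl k) i3 ≤ k ∧ k < (v * simpleRefl k) i1) ∨
    (∃ i1 i2 i3 i4, Is3412At n (v * simpleRefl k) i1 i2 i3 i4 ∧ i2 ≤ k ∧ k < i3 ∧
        (v * simpleRefl k) i4 ≤ k ∧ k < (v * simpleRefl k) i1) := by
  obtain ⟨L, ⟨⟨hL, hLv⟩, hLr⟩, hkL⟩ := hsupp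
  have hinv := exists_inv n k L hL (by rw [hLv]; exact hLr) hkL
  rw [hLv] at hinv
  obtain ⟨i0, j0, hij0, hj0, hi0⟩ := hinv
  have hup : v k < v (k + 1) := by
    have := len_cases n v k hk1 hk2
    omega
  -- some early position with a large value
  have hI : ∃ i ≤ k, k < v i := by
    by_contra! hc
    have h1 := pres_compl v k hc j0 hj0
    have h2 := hc i0 (by omega)
    omega
  -- some late position with a small value
  have hJ : ∃ j, k < j ∧ v j ≤ k := by
    by_contra! hc
    obtain ⟨i, hi, hvi⟩ := hI
    have h1 := pres_compl v⁻¹ k (fun x hx => by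
      by_contra hx'
      have := hc (v⁻¹ x) (by omega)
      simp at this
      omega) (v i) (by simpa using hi)
    omega
  obtain ⟨i, hik, hvi⟩ := hI
  obtain ⟨j, hjk, hvj⟩ := hJ
  have hi1 : 1 ≤ i := by
    by_contra hc
    have := hv i (by simp; omega)
    omega
  have hjn : j ≤ n := by
    by_contra hc
    have := hv j (by simp; omega)
    omega
  have eA : (v * simpleRefl k) k = v (k + 1) := by simp [simpleRefl]
  have eB : (v * simpleRefl k) (k + 1) = v k := by simp [simpleRefl]
  have eI : i ≠ k → (v * simpleRefl k) i = v i := fun h => by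
    rw [Equiv.Perm.mul_apply, sr_apply, if_neg h, if_neg (by omega)]
  have eJ : j ≠ k + 1 → (v * simpleRefl k) j = v j := fun h => by
    rw [Equiv.Perm.mul_apply, sr_apply, if_neg (by omega), if_neg h]
  unfold Is321At Is3412At
  generalize v * simpleRefl k = u at *
  by_cases hq : k < v k
  · have hne : j ≠ k + 1 := by rintro rfl; omega
    have := eJ hne
    exact Or.inl ⟨k, k + 1, j, by omega, by omega, by omega, by omega, by omega⟩
  have hine : i ≠ k := by rintro rfl; omega
  have eI := eI hine
  by_cases hp : v (k + 1) ≤ k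
  · exact Or.inl ⟨i, k, k + 1, by omega, by omega, by omega, by omega, by omega⟩
  have hjne : j ≠ k + 1 := by rintro rfl; omega
  have eJ := eJ hjne
  have n1 : v i ≠ v (k + 1) := fun h => by have := v.injective h; omega
  have n2 : v j ≠ v k := fun h => by have := v.injective h; omega
  by_cases h1 : v (k + 1) < v i
  · exact Or.inl ⟨i, k, k + 1, by omega, by omega, by omega, by omega, by omega⟩
  by_cases h2 : v j < v k
  · exact Or.inl ⟨k, k + 1, j, by omega, by omega, by omega, by omega, by omega⟩
  exact Or.inr ⟨i, k, k + 1, j, by omega, by omega, by omega, by omega, by omega⟩
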